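/- Let X be a real Banach space admitting a C¹ Lipschitz bump function, let H : [0,∞) × X × ℝ → ℝ be a continuous Hamiltonian satisfying the evolution condition (A), and let h : X → ℝ be bounded and continuous. Suppose u : [0,∞) × X → ℝ is a viscosity subsolution of u_t + H(t, x, ‖u_x‖) = 0 with u(0,·) ≤ h, v : [0,∞) × X → ℝ is a viscosity supersolution with v(0,·) ≥ h, both u and v are bounded on [0,T) × X for every T > 0, and for every (t,x) ∈ (0,∞) × X at least one of u, v is Lipschitz (with respect to the metric |s−s'| + ‖y−y'‖) on some neighborhood of (t,x). Then inf_{[0,∞)×X} (v − u) ≥ 0, i.e. u ≤ v. -/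

import Mathlib

open Filter Topology

variable {X : Type*} [NormedAddCommGroup X] [NormedSpace ℝ X]

/-- `X` admits a `C¹` Lipschitz bump function. -/
def HasC1LipBump (X : Type*) [NormedAddCommGroup X] [NormedSpace ℝ X] : Prop :=
  ∃ b : X → ℝ, ContDiff ℝ 1 b ∧ (∃ K : NNReal, LipschitzWith K b) ∧
    Bornology.IsBounded (Function.support b) ∧ (Function.support b).Nonempty

/-- The parabolic superdifferential of `u : [0,∞) × X → ℝ` at `(t,x)`. -/
def psuperdiff (u : ℝ → X → ℝ) (t : ℝ) (x : X) : Set (ℝ × (X →L[ℝ] ℝ)) :=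
  {p | ∀ ε > (0:ℝ), ∃ δ > (0:ℝ), ∀ (s : ℝ) (k : X), |s| + ‖k‖ < δ → 0 ≤ t + s →
    u (t + s) (x + k) ≤ u t x + p.1 * s + p.2 k + ε * (|s| + ‖k‖)}

/-- The parabolic subdifferential of `u : [0,∞) × X → ℝ` at `(t,x)`. -/
def psubdiff (u : ℝ → X → ℝ) (t : ℝ) (x : X) : Set (ℝ × (X →L[ℝ] ℝ)) :=
  {p | ∀ ε > (0:ℝ), ∃ δ > (0:ℝ), ∀ (s : ℝ) (k : X), |s| + ‖k‖ < δ → 0 ≤ t + s →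
    u t x + p.1 * s + p.2 k - ε * (|s| + ‖k‖) ≤ u (t + s) (x + k)}

/-- The evolution condition (A) for a Hamiltonian `H : [0,∞) × X × ℝ → ℝ`. -/
def CondAEvol (H : ℝ → X → ℝ → ℝ) : Prop :=
  ∃ (C : ℝ) (ω : ℝ → ℝ → ℝ → ℝ), 0 ≤ C ∧
    ContinuousOn (fun p : ℝ × ℝ × ℝ => ω p.1 p.2.1 p.2.2) {p : ℝ × ℝ × ℝ | 0 ≤ p.1} ∧
    ω 0 0 0 = 0 ∧
    ∀ (t₁ t₂ : ℝ), 0 ≤ t₁ → 0 ≤ t₂ → ∀ (x₁ x₂ : X) (r₁ r₂ : ℝ),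
      |H t₁ x₁ r₁ - H t₂ x₂ r₂| ≤
        ω |t₁ - t₂| ‖x₁ - x₂‖ (r₁ - r₂) + C * max |r₁| |r₂| * (|t₁ - t₂| + ‖x₁ - x₂‖)

/-- `u` is a viscosity subsolution of `u_t + H(t, x, ‖u_x‖) = 0` with
initial condition `u(0,·) ≤ h`. -/
def IsEvolSub (H : ℝ → X → ℝ → ℝ) (h : X → ℝ) (u : ℝ → X → ℝ) : Prop :=
  UpperSemicontinuousOn (fun p : ℝ × X => u p.1 p.2) {p : ℝ × X | 0 ≤ p.1} ∧
  (∀ t : ℝ, 0 < t → ∀ x : X, ∀ p ∈ psuperdiff u t x, p.1 + H t x ‖p.2‖ ≤ 0) ∧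
  (∀ x : X, u 0 x ≤ h x)

/-- `v` is a viscosity supersolution of `v_t + H(t, x, ‖v_x‖) = 0` with
initial condition `v(0,·) ≥ h`. -/
def IsEvolSuper (H : ℝ → X → ℝ → ℝ) (h : X → ℝ) (v : ℝ → X → ℝ) : Prop :=
  LowerSemicontinuousOn (fun p : ℝ × X => v p.1 p.2) {p : ℝ × X | 0 ≤ p.1} ∧
  (∀ t : ℝ, 0 < t → ∀ x : X, ∀ p ∈ psubdiff v t x, 0 ≤ p.1 + H t x ‖p.2‖) ∧
  (∀ x : X, h x ≤ v 0 x)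

/-- A differentiable bump function, supported in the unit ball, equal to its maximum `1` at the
origin and with bounded derivative. -/
def IsUnitBump {E : Type*} [NormedAddCommGroup E] [NormedSpace ℝ E] (b : E → ℝ) (L : ℝ) : Prop :=
  Differentiable ℝ b ∧ (∀ z, ‖fderiv ℝ b z‖ ≤ L) ∧ (∀ z, 0 ≤ b z) ∧ (∀ z, b z ≤ 1) ∧ b 0 = 1 ∧
    ∀ z, 1 ≤ ‖z‖ → b z = 0

lemma HasC1LipBump.exists_isUnitBump {E : Type*} [NormedAddCommGroup E] [NormedSpace ℝ E]
    (hE : HasC1LipBump E) : ∃ (b : E → ℝ) (L : ℝ), IsUnitBump b L := by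
  obtain ⟨b, hb, ⟨K, hK⟩, hbdd, x₀, hx₀⟩ := hE
  have hx₀ : b x₀ ≠ 0 := hx₀
  obtain ⟨R, hR⟩ := hbdd.subset_closedBall x₀
  set ρ : ℝ := |R| + 1 with hρ
  have hρ0 : 0 < ρ := by positivity
  set a : ℝ := Real.pi / 2 / b x₀ with ha
  have hd : ∀ z, HasFDerivAt (fun z => Real.sin (a * b (x₀ + ρ • z)) ^ 2)
      ((2 * Real.sin (a * b (x₀ + ρ • z)) * Real.cos (a * b (x₀ + ρ • z)) * a * ρ) •
        fderiv ℝ b (x₀ + ρ • z)) z := by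
    intro z
    have h1 : HasFDerivAt (fun z : E => x₀ + ρ • z) (ρ • ContinuousLinearMap.id ℝ E) z :=
      ((hasFDerivAt_id z).const_smul ρ).const_add x₀
    have h2 := (((hb.differentiable one_ne_zero (x₀ + ρ • z)).hasFDerivAt.comp z h1).const_mul
      a).sin.pow 2
    refine h2.congr_fderiv ?_
    ext k
    simp
    ring
  refine ⟨fun z => Real.sin (a * b (x₀ + ρ • z)) ^ 2, 2 * |a| * ρ * K,
    fun z => (hd z).differentiableAt, fun z => ?_, fun z => sq_nonneg _,
    fun z => Real.sin_sq_le_one _, ?_, fun z hz => ?_⟩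
  · rw [(hd z).fderiv, norm_smul]
    refine mul_le_mul ?_ (norm_fderiv_le_of_lipschitz ℝ hK) (norm_nonneg _) (by positivity)
    rw [Real.norm_eq_abs, abs_mul, abs_mul, abs_mul, abs_mul, abs_of_pos hρ0, abs_two]
    have h1 := Real.abs_sin_le_one (a * b (x₀ + ρ • z))
    have h2 := Real.abs_cos_le_one (a * b (x₀ + ρ • z))
    have h3 : |Real.sin (a * b (x₀ + ρ • z))| * |Real.cos (a * b (x₀ + ρ • z))| ≤ 1 :=
      mul_le_one₀ h1 (abs_nonneg _) h2
    calc _ = 2 * (|Real.sin (a * b (x₀ + ρ • z))| * |Real.cos (a * b (x₀ + ρ • z))|) * |a| * ρ := by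
          ring
      _ ≤ 2 * 1 * |a| * ρ := by gcongr
      _ = _ := by ring
  · have : a * b x₀ = Real.pi / 2 := by rw [ha]; field_simp
    simp [this]
  · have : b (x₀ + ρ • z) = 0 := by
      by_contra hne
      have h1 := hR (show x₀ + ρ • z ∈ Function.support b from hne)
      rw [Metric.mem_closedBall, dist_eq_norm, add_sub_cancel_left, norm_smul, Real.norm_eq_abs,
        abs_of_pos hρ0] at h1
      nlinarith [le_abs_self R]
    simp [this]

lemma hasC1LipBump_real : HasC1LipBump ℝ := by
  let f : ContDiffBump (0 : ℝ) := ⟨1, 2, one_pos, one_lt_two⟩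
  refine ⟨f, f.contDiff, f.contDiff.lipschitzWith_of_hasCompactSupport f.hasCompactSupport
    one_ne_zero, ?_, 0, ?_⟩
  · rw [f.support_eq]
    exact Metric.isBounded_ball
  · rw [f.support_eq]
    simp [f]

lemma IsUnitBump.prod {E F : Type*} [NormedAddCommGroup E] [NormedSpace ℝ E]
    [NormedAddCommGroup F] [NormedSpace ℝ F] {b : E → ℝ} {c : F → ℝ} {L M : ℝ}
    (hb : IsUnitBump b L) (hc : IsUnitBump c M) :
    IsUnitBump (fun z : E × F => b z.1 * c z.2) (L + M) := by
  obtain ⟨hb1, hb2, hb3, hb4, hb5, hb6⟩ := hb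
  obtain ⟨hc1, hc2, hc3, hc4, hc5, hc6⟩ := hc
  have hd : ∀ z : E × F, HasFDerivAt (fun z : E × F => b z.1 * c z.2)
      (b z.1 • (fderiv ℝ c z.2).comp (ContinuousLinearMap.snd ℝ E F) +
        c z.2 • (fderiv ℝ b z.1).comp (ContinuousLinearMap.fst ℝ E F)) z := fun z =>
    ((hb1 z.1).hasFDerivAt.comp z hasFDerivAt_fst).mul
      ((hc1 z.2).hasFDerivAt.comp z hasFDerivAt_snd)
  refine ⟨fun z => (hd z).differentiableAt, fun z => ?_, fun z => mul_nonneg (hb3 _) (hc3 _),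
    fun z => mul_le_one₀ (hb4 _) (hc3 _) (hc4 _), by simp [hb5, hc5], fun z hz => ?_⟩
  · rw [(hd z).fderiv, add_comm L M]
    have key : ∀ {s l n A : ℝ}, 0 ≤ s → s ≤ 1 → 0 ≤ l → l ≤ A → 0 ≤ n → n ≤ 1 →
        s * (l * n) ≤ A := by
      intro s l n A hs hs1 hl hlA hn hn1
      have h1 : l * n ≤ l := mul_le_of_le_one_right hl hn1
      have h2 : s * (l * n) ≤ l * n := mul_le_of_le_one_left (by positivity) hs1
      linarith
    refine (norm_add_le _ _).trans (add_le_add ?_ ?_) <;>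
      rw [norm_smul, Real.norm_eq_abs, abs_of_nonneg (by first | exact hb3 _ | exact hc3 _)]
    · exact (mul_le_mul_of_nonneg_left (ContinuousLinearMap.opNorm_comp_le _ _) (hb3 _)).trans
        (key (hb3 _) (hb4 _) (norm_nonneg _) (hc2 _) (norm_nonneg _)
          (ContinuousLinearMap.norm_snd_le ℝ E F))
    · exact (mul_le_mul_of_nonneg_left (ContinuousLinearMap.opNorm_comp_le _ _) (hc3 _)).trans
        (key (hc3 _) (hc4 _) (norm_nonneg _) (hb2 _) (norm_nonneg _)
          (ContinuousLinearMap.norm_fst_le ℝ E F))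
  · rcases le_max_iff.1 (show 1 ≤ max ‖z.1‖ ‖z.2‖ from hz) with h | h
    · simp [hb6 _ h]
    · simp [hc6 _ h]

/-- Smooth variational principle of Deville–Godefroy–Zizler: a bounded above upper semicontinuous
function attains a strong maximum after a small smooth perturbation. -/
lemma IsUnitBump.exists_perturbation_strongMax {E : Type*} [NormedAddCommGroup E]
    [NormedSpace ℝ E] [CompleteSpace E] {b : E → ℝ} {L : ℝ} (hb : IsUnitBump b L) {S : Set E}
    (hS : IsClosed S) (hne : S.Nonempty) {f : E → ℝ} (hf : UpperSemicontinuousOn f S)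
    (hbd : BddAbove (f '' S)) {ε : ℝ} (hε : 0 < ε) :
    ∃ g : E → ℝ, Differentiable ℝ g ∧ (∀ z, |g z| ≤ ε) ∧ (∀ z, ‖fderiv ℝ g z‖ ≤ ε) ∧
      ∃ z₀ ∈ S, (∀ z ∈ S, f z + g z ≤ f z₀ + g z₀) ∧
        ∀ η > 0, ∃ δ > 0, ∀ z ∈ S, f z₀ + g z₀ - δ ≤ f z + g z → ‖z - z₀‖ < η := by
  classical
  obtain ⟨hb1, hb2, hb3, hb4, hb5, hb6⟩ := hb
  have hL : 0 ≤ L := (norm_nonneg _).trans (hb2 0)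
  set κ : ℝ := ε / (2 * (L + 1)) with hκ
  have hκ0 : 0 < κ := by positivity
  have hκε : κ * (2 * (L + 1)) = ε := by rw [hκ]; field_simp
  set c : ℕ → ℝ := fun n => κ * (1 / 8) ^ n with hc
  have hc0 : ∀ n, 0 < c n := fun n => by positivity
  have hstep : ∀ (n : ℕ) (F : E → ℝ), ∃ z, BddAbove (F '' S) →
      z ∈ S ∧ ∀ y ∈ S, F y < F z + c n / 2 := by
    intro n F
    by_cases hF : BddAbove (F '' S)
    · obtain ⟨_, ⟨z, hz, rfl⟩, hlt⟩ := exists_lt_of_lt_csSup (hne.image F)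
        (sub_lt_self (sSup (F '' S)) (half_pos (hc0 n)))
      refine ⟨z, fun _ => ⟨hz, fun y hy => ?_⟩⟩
      linarith [le_csSup hF (Set.mem_image_of_mem F hy)]
    · exact ⟨0, fun h => absurd h hF⟩
  choose step hstep using hstep
  let G : ℕ → E → ℝ := fun n => Nat.rec (fun _ => 0)
    (fun k g z => g z + c k * b ((2 : ℝ) ^ k • (z - step k (fun y => f y + g y)))) n
  set x : ℕ → E := fun n => step n (fun y => f y + G n y) with hx
  set τ : ℕ → E → ℝ := fun n z => c n * b ((2 : ℝ) ^ n • (z - x n)) with hτ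
  have hG0 : ∀ z, G 0 z = 0 := fun z => rfl
  have hGs : ∀ n z, G (n + 1) z = G n z + τ n z := fun n z => rfl
  have hGsum : ∀ n z, G n z = ∑ k ∈ Finset.range n, τ k z := by
    intro n z
    induction n with
    | zero => simp [hG0]
    | succ k ih => rw [hGs, ih, Finset.sum_range_succ]
  have hτ0 : ∀ n z, 0 ≤ τ n z := fun n z => mul_nonneg (hc0 n).le (hb3 _)
  have hτc : ∀ n z, τ n z ≤ c n := fun n z => mul_le_of_le_one_right (hc0 n).le (hb4 _)
  have hcsum : HasSum c (κ * (8 / 7)) := by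
    have := (hasSum_geometric_of_lt_one (r := (1 / 8 : ℝ)) (by norm_num) (by norm_num)).mul_left κ
    norm_num at this
    simpa [hc] using this
  have hτsum : ∀ z, Summable fun n => τ n z := fun z =>
    hcsum.summable.of_nonneg_of_le (fun n => hτ0 n z) (fun n => hτc n z)
  have hbdG : ∀ n, BddAbove ((fun y => f y + G n y) '' S) := by
    intro n
    obtain ⟨M, hM⟩ := hbd
    refine ⟨M + κ * (8 / 7), ?_⟩
    rintro _ ⟨y, hy, rfl⟩
    have h1 := hM (Set.mem_image_of_mem f hy)
    have h2 : G n y ≤ κ * (8 / 7) := by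
      rw [hGsum]
      exact (Finset.sum_le_sum fun k _ => hτc k y).trans
        (sum_le_hasSum _ (fun k _ => (hc0 k).le) hcsum)
    exact add_le_add h1 h2
  have hxS : ∀ n, x n ∈ S := fun n => (hstep n _ (hbdG n)).1
  have hxlt : ∀ n, ∀ y ∈ S, f y + G n y < f (x n) + G n (x n) + c n / 2 :=
    fun n => (hstep n _ (hbdG n)).2
  set g : E → ℝ := fun z => ∑' n, τ n z with hg
  have hgle : ∀ n z, G n z ≤ g z := fun n z => by
    rw [hGsum]
    exact (hτsum z).sum_le_tsum _ fun k _ => hτ0 k z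
  have hgtail : ∀ n z, g z ≤ G (n + 1) z + c n / 7 := by
    intro n z
    have h1 := (hτsum z).sum_add_tsum_nat_add (n + 1)
    have h2 : HasSum (fun k => c (k + (n + 1))) (c n / 7) := by
      have h := hcsum.mul_left ((1 / 8 : ℝ) ^ (n + 1))
      rw [show (1 / 8 : ℝ) ^ (n + 1) * (κ * (8 / 7)) = c n / 7 by simp only [c]; ring] at h
      have hshift : (fun k => c (k + (n + 1))) = fun k => (1 / 8 : ℝ) ^ (n + 1) * c k := by
        funext k
        simp only [c]
        ring
      rwa [hshift]
    have h3 : ∑' k, τ (k + (n + 1)) z ≤ c n / 7 := by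
      rw [← h2.tsum_eq]
      exact ((summable_nat_add_iff (n + 1)).2 (hτsum z)).tsum_le_tsum
        (fun k => hτc _ z) h2.summable
    rw [← hGsum] at h1
    change _ = g z at h1
    linarith
  have hg0 : ∀ z, 0 ≤ g z := fun z => tsum_nonneg fun n => hτ0 n z
  have hgε : ∀ z, g z ≤ ε := by
    intro z
    have := (hτsum z).tsum_le_tsum (fun n => hτc n z) hcsum.summable
    rw [hcsum.tsum_eq] at this
    change g z ≤ _ at this
    nlinarith
  have hτd : ∀ n z, HasFDerivAt (τ n)
      ((c n * 2 ^ n) • fderiv ℝ b ((2 : ℝ) ^ n • (z - x n))) z := by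
    intro n z
    have h1 : HasFDerivAt (fun z : E => (2 : ℝ) ^ n • (z - x n))
        ((2 : ℝ) ^ n • ContinuousLinearMap.id ℝ E) z :=
      ((hasFDerivAt_id z).sub_const (x n)).const_smul _
    have h2 := ((hb1 ((2 : ℝ) ^ n • (z - x n))).hasFDerivAt.comp z h1).const_mul (c n)
    refine h2.congr_fderiv ?_
    ext k
    simp
    ring
  have hdb : ∀ n z, ‖(c n * 2 ^ n) • fderiv ℝ b ((2 : ℝ) ^ n • (z - x n))‖ ≤
      κ * L * (1 / 4) ^ n := by
    intro n z
    have h8 : c n * 2 ^ n = κ * (1 / 4) ^ n := by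
      simp only [hc]
      rw [mul_assoc, ← mul_pow]
      norm_num
    rw [norm_smul, h8, Real.norm_eq_abs, abs_of_pos (by positivity)]
    calc _ ≤ κ * (1 / 4) ^ n * L := by gcongr; exact hb2 _
      _ = _ := by ring
  have hdsum : HasSum (fun n : ℕ => κ * L * (1 / 4 : ℝ) ^ n) (κ * L * (4 / 3)) := by
    have := (hasSum_geometric_of_lt_one (r := (1 / 4 : ℝ)) (by norm_num) (by norm_num)).mul_left
      (κ * L)
    norm_num at this
    simpa using this
  have hgd : ∀ z, HasFDerivAt g
      (∑' n, (c n * 2 ^ n) • fderiv ℝ b ((2 : ℝ) ^ n • (z - x n))) z := fun z =>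
    hasFDerivAt_tsum hdsum.summable hτd hdb (hτsum z) z
  have hgdiff : Differentiable ℝ g := fun z => (hgd z).differentiableAt
  have hloc : ∀ n, ∀ z ∈ S, f (x n) + g (x n) - c n / 8 ≤ f z + g z →
      ‖z - x n‖ < (1 / 2) ^ n := by
    intro n z hz hle
    by_contra! hfar
    have h1 : τ n z = 0 := by
      have : 1 ≤ ‖(2 : ℝ) ^ n • (z - x n)‖ := by
        rw [norm_smul, norm_pow, Real.norm_two]
        calc (1 : ℝ) = 2 ^ n * (1 / 2) ^ n := by rw [← mul_pow]; norm_num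
          _ ≤ _ := by gcongr
      simp [hτ, hb6 _ this]
    have h2 : τ n (x n) = c n := by simp [hτ, hb5]
    have h3 := hgle (n + 1) (x n)
    have h4 := hgtail n z
    rw [hGs] at h3 h4
    linarith [hxlt n z hz, hc0 n]
  have hbdh : BddAbove ((fun y => f y + g y) '' S) := by
    obtain ⟨M, hM⟩ := hbd
    refine ⟨M + ε, ?_⟩
    rintro _ ⟨y, hy, rfl⟩
    exact add_le_add (hM (Set.mem_image_of_mem f hy)) (hgε y)
  set s : ℝ := sSup ((fun y => f y + g y) '' S) with hs
  have hles : ∀ z ∈ S, f z + g z ≤ s := fun z hz => le_csSup hbdh ⟨z, hz, rfl⟩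
  have hw : ∀ n, ∃ z ∈ S, s - c n / 8 < f z + g z := by
    intro n
    obtain ⟨_, ⟨z, hz, rfl⟩, hlt⟩ := exists_lt_of_lt_csSup (hne.image (fun y => f y + g y))
      (sub_lt_self s (by have := hc0 n; positivity : 0 < c n / 8))
    exact ⟨z, hz, hlt⟩
  choose w hwS hwlt using hw
  have hcanti : ∀ {n m : ℕ}, n ≤ m → c m ≤ c n := fun {n m} hnm =>
    mul_le_mul_of_nonneg_left (pow_le_pow_of_le_one (by norm_num) (by norm_num) hnm) hκ0.le
  have hwx : ∀ n m, n ≤ m → dist (w m) (x n) < (1 / 2) ^ n := by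
    intro n m hnm
    rw [dist_eq_norm]
    refine hloc n _ (hwS m) ?_
    linarith [hles _ (hxS n), hwlt m, hcanti hnm]
  have hr : Tendsto (fun n : ℕ => (1 / 2 : ℝ) ^ n) atTop (𝓝 0) :=
    tendsto_pow_atTop_nhds_zero_of_lt_one (by norm_num) (by norm_num)
  have hctend : Tendsto c atTop (𝓝 0) := by
    have := (tendsto_pow_atTop_nhds_zero_of_lt_one (r := (1 / 8 : ℝ)) (by norm_num)
      (by norm_num)).const_mul κ
    simpa [hc] using this
  have hcau : CauchySeq w := by
    refine cauchySeq_of_le_tendsto_0 (fun n => 2 * (1 / 2 : ℝ) ^ n) (fun m k n hm hk => ?_)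
      (by simpa using hr.const_mul 2)
    linarith [dist_triangle_right (w m) (w k) (x n), hwx n m hm, hwx n k hk]
  obtain ⟨z₀, hz₀⟩ := cauchySeq_tendsto_of_complete hcau
  have hz₀S : z₀ ∈ S := hS.mem_of_tendsto hz₀ (Eventually.of_forall hwS)
  have hmax : s ≤ f z₀ + g z₀ := by
    refine le_of_forall_pos_lt_add fun e he => ?_
    have husc : UpperSemicontinuousWithinAt (fun z => f z + g z) S z₀ :=
      UpperSemicontinuousWithinAt.add (hf z₀ hz₀S) (hgdiff.continuous.continuousWithinAt.upperSemicontinuousWithinAt)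
    have h1 : ∀ᶠ n in atTop, f (w n) + g (w n) < f z₀ + g z₀ + e / 2 :=
      (tendsto_nhdsWithin_iff.2 ⟨hz₀, Eventually.of_forall hwS⟩).eventually
        (husc _ (by linarith))
    obtain ⟨n, hn1, hn2⟩ := (h1.and (hctend.eventually (gt_mem_nhds he))).exists
    linarith [hwlt n, hc0 n]
  refine ⟨g, hgdiff, fun z => by rw [abs_of_nonneg (hg0 z)]; exact hgε z, fun z => ?_, z₀, hz₀S,
    fun z hz => (hles z hz).trans hmax, fun η hη => ?_⟩
  · rw [(hgd z).fderiv]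
    refine (tsum_of_norm_bounded hdsum fun n => hdb n z).trans ?_
    nlinarith [mul_nonneg hκ0.le hL]
  · obtain ⟨n, hn⟩ := (hr.eventually (gt_mem_nhds (half_pos hη))).exists
    refine ⟨c n / 8, by have := hc0 n; positivity, fun z hz hle => ?_⟩
    have h1 := hloc n z hz (by linarith [hles _ (hxS n)])
    have h2 := hloc n z₀ hz₀S (by linarith [hles _ (hxS n), hc0 n])
    rw [← dist_eq_norm] at h1 h2 ⊢
    linarith [dist_triangle_right z z₀ (x n)]

/-- The Fréchet superdifferential of a function at a point. -/
def superdiff {E : Type*} [NormedAddCommGroup E] [NormedSpace ℝ E] (f : E → ℝ) (z : E) :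
    Set (E →L[ℝ] ℝ) :=
  {p | ∀ ε > 0, ∀ᶠ y in 𝓝 z, f y ≤ f z + p (y - z) + ε * ‖y - z‖}

lemma superdiff_add_fderiv {E : Type*} [NormedAddCommGroup E] [NormedSpace ℝ E] {f φ : E → ℝ}
    {z : E} {p φ' : E →L[ℝ] ℝ} (hp : p ∈ superdiff (fun y => f y - φ y) z)
    (hφ : HasFDerivAt φ φ' z) : p + φ' ∈ superdiff f z := by
  intro ε hε
  filter_upwards [hp (ε / 2) (half_pos hε), hφ.isLittleO.def (half_pos hε)] with y h1 h2
  rw [Real.norm_eq_abs] at h2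
  have h3 := (abs_le.1 h2).2
  simp only [add_apply]
  linarith

lemma fderiv_mem_superdiff {E : Type*} [NormedAddCommGroup E] [NormedSpace ℝ E] {f φ : E → ℝ}
    {z : E} {φ' : E →L[ℝ] ℝ} (hmax : IsLocalMax (fun y => f y - φ y) z)
    (hφ : HasFDerivAt φ φ' z) : φ' ∈ superdiff f z := by
  rw [← zero_add φ']
  refine superdiff_add_fderiv (fun ε hε => ?_) hφ
  filter_upwards [hmax] with y hy
  have : 0 ≤ ε * ‖y - z‖ := by positivity
  simpa using hy.trans (le_add_of_nonneg_right this)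

lemma norm_le_of_mem_superdiff {E : Type*} [NormedAddCommGroup E] [NormedSpace ℝ E] {f : E → ℝ}
    {z : E} {p : E →L[ℝ] ℝ} (hp : p ∈ superdiff f z) {K : ℝ} (hK : 0 ≤ K)
    (hf : ∀ᶠ y in 𝓝 z, |f y - f z| ≤ K * ‖y - z‖) : ‖p‖ ≤ K + 1 := by
  have h1 : ∀ᶠ k in 𝓝 (0 : E), -p k ≤ (K + 1) * ‖k‖ := by
    have ht : Tendsto (fun k : E => z + k) (𝓝 0) (𝓝 z) := by
      simpa using (continuous_const_add z).tendsto 0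
    filter_upwards [ht.eventually (hp 1 one_pos), ht.eventually hf] with k hk1 hk2
    rw [add_sub_cancel_left] at hk1 hk2
    linarith [(abs_le.1 hk2).1]
  have h2 : ∀ᶠ k in 𝓝 (0 : E), -p (-k) ≤ (K + 1) * ‖-k‖ := by
    have ht : Tendsto (fun k : E => -k) (𝓝 0) (𝓝 0) := by
      simpa using (continuous_neg (G := E)).tendsto 0
    exact ht.eventually h1
  refine ContinuousLinearMap.opNorm_le_of_nhds_zero (by positivity) ?_
  filter_upwards [h1, h2] with k hk1 hk2
  rw [map_neg, neg_neg, norm_neg] at hk2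
  exact abs_le.2 ⟨by linarith, hk2⟩

/-- Fuzzy difference rule at a strong maximum of `U - V`, with `U` Lipschitz. -/
lemma exists_superdiff_near_strongMax {E : Type*} [NormedAddCommGroup E]
    [NormedSpace ℝ E] [CompleteSpace E] {b : E → ℝ} {L : ℝ} (hb : IsUnitBump b L)
    {U V : E → ℝ} {z₀ : E} {ρ C K : ℝ} (hρ : 0 < ρ) (hK : 0 ≤ K)
    (hV : LowerSemicontinuousOn V (Metric.closedBall z₀ ρ))
    (hUC : ∀ z ∈ Metric.closedBall z₀ ρ, |U z| ≤ C)
    (hVC : ∀ z ∈ Metric.closedBall z₀ ρ, |V z| ≤ C)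
    (hUK : ∀ z ∈ Metric.closedBall z₀ ρ, ∀ y ∈ Metric.closedBall z₀ ρ,
      |U z - U y| ≤ K * ‖z - y‖)
    (hmax : ∀ η > 0, ∃ δ > 0, ∀ z ∈ Metric.closedBall z₀ ρ,
      U z₀ - V z₀ - δ ≤ U z - V z → ‖z - z₀‖ < η)
    {ε : ℝ} (hε : 0 < ε) :
    ∃ (z₁ z₂ : E) (p q : E →L[ℝ] ℝ), ‖z₁ - z₀‖ < ε ∧ ‖z₂ - z₀‖ < ε ∧ p ∈ superdiff U z₁ ∧
      -q ∈ superdiff (fun z => -V z) z₂ ∧ ‖p - q‖ < ε ∧ ‖p‖ ≤ K + 1 := by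
  wlog hερ : ε ≤ ρ generalizing ε
  · obtain ⟨z₁, z₂, p, q, h1, h2, h3, h4, h5, h6⟩ := this hρ le_rfl
    exact ⟨z₁, z₂, p, q, by linarith, by linarith, h3, h4, by linarith, h6⟩
  obtain ⟨δ, hδ, hδmax⟩ := hmax (ε / 2) (half_pos hε)
  have hz₀ : z₀ ∈ Metric.closedBall z₀ ρ := Metric.mem_closedBall_self hρ.le
  have hC : 0 ≤ C := (abs_nonneg _).trans (hUC z₀ hz₀)
  obtain ⟨hb1, hb2, hb3, hb4, hb5, hb6⟩ := id hb
  set A : ℝ := 4 * C + 1 with hA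
  have hA0 : 0 < A := by positivity
  obtain ⟨r, hr0, hrε, hrδ⟩ : ∃ r > 0, r ≤ ε / 2 ∧ K * r ≤ δ / 2 := by
    refine ⟨min (ε / 2) (δ / 2 / (K + 1)), by positivity, min_le_left _ _, ?_⟩
    calc K * min (ε / 2) (δ / 2 / (K + 1)) ≤ (K + 1) * (δ / 2 / (K + 1)) := by
          gcongr
          · linarith
          · exact min_le_right _ _
      _ = _ := by field_simp
  obtain ⟨e, he0, heε, heδ, he1⟩ : ∃ e > 0, e < ε / 2 ∧ e ≤ δ / 4 ∧ e ≤ 1 / 4 := by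
    refine ⟨min (ε / 4) (min (δ / 4) (1 / 4)), by positivity, ?_, ?_, ?_⟩
    · exact (min_le_left _ _).trans_lt (by linarith)
    · exact (min_le_right _ _).trans (min_le_left _ _)
    · exact (min_le_right _ _).trans (min_le_right _ _)
  set B := Metric.closedBall z₀ ρ with hB
  have hUcont : ContinuousOn U B := by
    refine (LipschitzOnWith.of_dist_le_mul (K := K.toNNReal) fun z hz y hy => ?_).continuousOn
    rw [Real.coe_toNNReal K hK, dist_eq_norm, dist_eq_norm]
    exact hUK z hz y hy
  let β : E → ℝ := fun z => A * b (r⁻¹ • z)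
  have hβ : Differentiable ℝ β := (hb1.comp (differentiable_id.const_smul r⁻¹)).const_mul A
  obtain ⟨G, hGd, hGe, hGe', ⟨z₁, z₂⟩, ⟨hz₁, hz₂⟩, hmaxG, -⟩ :=
    (hb.prod hb).exists_perturbation_strongMax (S := B ×ˢ B)
      (f := fun z => U z.1 + -V z.2 + β (z.1 - z.2))
      (Metric.isClosed_closedBall.prod Metric.isClosed_closedBall) ⟨(z₀, z₀), hz₀, hz₀⟩
      (by
        intro z hz
        refine UpperSemicontinuousWithinAt.add (UpperSemicontinuousWithinAt.add ?_ ?_) ?_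
        · exact ((hUcont z.1 hz.1).comp continuousWithinAt_fst
            (fun y hy => hy.1)).upperSemicontinuousWithinAt
        · intro y hy
          have h1 := hV z.2 hz.2 (-y) (by linarith)
          have h2 : Tendsto (Prod.snd : E × E → E) (𝓝[B ×ˢ B] z) (𝓝[B] z.2) :=
            continuousWithinAt_snd.tendsto_nhdsWithin fun y hy => hy.2
          filter_upwards [h2.eventually h1] with w hw
          linarith
        · exact ((hβ.continuous.comp (continuous_fst.sub continuous_snd)).continuousWithinAt
            ).upperSemicontinuousWithinAt)
      (by
        refine ⟨C + C + A, ?_⟩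
        rintro _ ⟨z, hz, rfl⟩
        have h1 := (abs_le.1 (hUC _ hz.1)).2
        have h2 := (abs_le.1 (hVC _ hz.2)).1
        have h3 : β (z.1 - z.2) ≤ A := mul_le_of_le_one_right hA0.le (hb4 _)
        dsimp only
        linarith) he0
  dsimp only at hz₁ hz₂ hmaxG
  have hβA : ∀ z, β z ≤ A := fun z => mul_le_of_le_one_right hA0.le (hb4 _)
  have hcmp := hmaxG (z₀, z₀) ⟨hz₀, hz₀⟩
  have hβ0 : β (z₀ - z₀) = A := by simp [β, hb5]
  rw [hβ0] at hcmp
  have hG1 := (abs_le.1 (hGe (z₀, z₀))).1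
  have hG2 := (abs_le.1 (hGe (z₁, z₂))).2
  have hclose : ‖z₁ - z₂‖ < r := by
    by_contra! hfar
    have : β (z₁ - z₂) = 0 := by
      have : 1 ≤ ‖r⁻¹ • (z₁ - z₂)‖ := by
        rw [norm_smul, norm_inv, Real.norm_eq_abs, abs_of_pos hr0, ← div_eq_inv_mul,
          one_le_div hr0]
        exact hfar
      simp [β, hb6 _ this]
    linarith [(abs_le.1 (hUC _ hz₁)).2, (abs_le.1 (hVC _ hz₂)).1, (abs_le.1 (hUC _ hz₀)).1,
      (abs_le.1 (hVC _ hz₀)).2]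
  have hU12 : U z₁ - U z₂ ≤ δ / 2 := by
    refine ((le_abs_self _).trans (hUK _ hz₁ _ hz₂)).trans (le_trans ?_ hrδ)
    gcongr
  have hnear₂ : ‖z₂ - z₀‖ < ε / 2 := hδmax z₂ hz₂ (by linarith [hβA (z₁ - z₂)])
  have hnear₁ : ‖z₁ - z₀‖ < ε := by
    have := norm_add_le (z₁ - z₂) (z₂ - z₀)
    rw [sub_add_sub_cancel] at this
    linarith
  have hnhds : ∀ {z}, ‖z - z₀‖ < ε → B ∈ 𝓝 z := fun {z} hz =>
    mem_of_superset (Metric.isOpen_ball.mem_nhds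
      (show z ∈ Metric.ball z₀ ε by rwa [Metric.mem_ball, dist_eq_norm]))
      (Metric.ball_subset_closedBall.trans (Metric.closedBall_subset_closedBall hερ))
  have hB₁ := hnhds hnear₁
  have hB₂ := hnhds (show ‖z₂ - z₀‖ < ε by linarith)
  set D := fderiv ℝ β (z₁ - z₂) with hD
  set D' := fderiv ℝ G (z₁, z₂) with hD'
  have hβd := (hβ (z₁ - z₂)).hasFDerivAt
  have hGd' := (hGd (z₁, z₂)).hasFDerivAt
  have hφ₁ : HasFDerivAt (fun z => -(β (z - z₂) + G (z, z₂)))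
      (-(D + D'.comp (ContinuousLinearMap.inl ℝ E E))) z₁ := by
    have h1 := hβd.comp z₁ ((hasFDerivAt_id z₁).sub_const z₂)
    have h2 := hGd'.comp z₁ (hasFDerivAt_prodMk_left (𝕜 := ℝ) z₁ z₂)
    exact (h1.add h2).neg
  have hφ₂ : HasFDerivAt (fun z => -(β (z₁ - z) + G (z₁, z)))
      (-(-D + D'.comp (ContinuousLinearMap.inr ℝ E E))) z₂ := by
    have h1 := hβd.comp z₂ ((hasFDerivAt_id z₂).const_sub z₁)
    have h2 := hGd'.comp z₂ (hasFDerivAt_prodMk_right (𝕜 := ℝ) z₁ z₂)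
    refine (h1.add h2).neg.congr_fderiv ?_
    ext k
    simp [D, D']
  have hp : -(D + D'.comp (ContinuousLinearMap.inl ℝ E E)) ∈ superdiff U z₁ := by
    refine fderiv_mem_superdiff ?_ hφ₁
    filter_upwards [hB₁] with z hz
    linarith [hmaxG (z, z₂) ⟨hz, hz₂⟩]
  have hq : -(-D + D'.comp (ContinuousLinearMap.inr ℝ E E)) ∈ superdiff (fun z => -V z) z₂ := by
    refine fderiv_mem_superdiff ?_ hφ₂
    filter_upwards [hB₂] with z hz
    linarith [hmaxG (z₁, z) ⟨hz₁, hz⟩]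
  refine ⟨z₁, z₂, _, -D + D'.comp (ContinuousLinearMap.inr ℝ E E), hnear₁, by linarith, hp, hq,
    ?_, norm_le_of_mem_superdiff hp hK ?_⟩
  · have h1 : ‖D'.comp (ContinuousLinearMap.inl ℝ E E)‖ ≤ e :=
      (ContinuousLinearMap.opNorm_comp_le _ _).trans ((mul_le_of_le_one_right (norm_nonneg _)
        (ContinuousLinearMap.norm_inl_le_one ℝ E E)).trans (hGe' _))
    have h2 : ‖D'.comp (ContinuousLinearMap.inr ℝ E E)‖ ≤ e :=
      (ContinuousLinearMap.opNorm_comp_le _ _).trans ((mul_le_of_le_one_right (norm_nonneg _)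
        (ContinuousLinearMap.norm_inr_le_one ℝ E E)).trans (hGe' _))
    rw [show -(D + D'.comp (ContinuousLinearMap.inl ℝ E E)) -
        (-D + D'.comp (ContinuousLinearMap.inr ℝ E E)) =
        -(D'.comp (ContinuousLinearMap.inl ℝ E E) + D'.comp (ContinuousLinearMap.inr ℝ E E)) by
      abel, norm_neg]
    linarith [norm_add_le (D'.comp (ContinuousLinearMap.inl ℝ E E))
      (D'.comp (ContinuousLinearMap.inr ℝ E E))]
  · filter_upwards [hB₁] with z hz using hUK z hz z₁ hz₁

/-- Fuzzy difference rule at a strong maximum of `U - V`, with `U` or `V` Lipschitz. -/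
lemma exists_superdiff_subdiff_near_strongMax {E : Type*} [NormedAddCommGroup E]
    [NormedSpace ℝ E] [CompleteSpace E] {b : E → ℝ} {L : ℝ} (hb : IsUnitBump b L)
    {U V : E → ℝ} {z₀ : E} {ρ C K : ℝ} (hρ : 0 < ρ) (hK : 0 ≤ K)
    (hU : UpperSemicontinuousOn U (Metric.closedBall z₀ ρ))
    (hV : LowerSemicontinuousOn V (Metric.closedBall z₀ ρ))
    (hUC : ∀ z ∈ Metric.closedBall z₀ ρ, |U z| ≤ C)
    (hVC : ∀ z ∈ Metric.closedBall z₀ ρ, |V z| ≤ C)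
    (hUVK : (∀ z ∈ Metric.closedBall z₀ ρ, ∀ y ∈ Metric.closedBall z₀ ρ,
      |U z - U y| ≤ K * ‖z - y‖) ∨ (∀ z ∈ Metric.closedBall z₀ ρ,
      ∀ y ∈ Metric.closedBall z₀ ρ, |V z - V y| ≤ K * ‖z - y‖))
    (hmax : ∀ η > 0, ∃ δ > 0, ∀ z ∈ Metric.closedBall z₀ ρ,
      U z₀ - V z₀ - δ ≤ U z - V z → ‖z - z₀‖ < η)
    {ε : ℝ} (hε : 0 < ε) :
    ∃ (z₁ z₂ : E) (p q : E →L[ℝ] ℝ), ‖z₁ - z₀‖ < ε ∧ ‖z₂ - z₀‖ < ε ∧ p ∈ superdiff U z₁ ∧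
      -q ∈ superdiff (fun z => -V z) z₂ ∧ ‖p - q‖ < ε ∧ ‖p‖ ≤ K + 1 + ε ∧ ‖q‖ ≤ K + 1 + ε := by
  rcases hUVK with hUK | hVK
  · obtain ⟨z₁, z₂, p, q, h1, h2, h3, h4, h5, h6⟩ :=
      exists_superdiff_near_strongMax hb hρ hK hV hUC hVC hUK hmax hε
    refine ⟨z₁, z₂, p, q, h1, h2, h3, h4, h5, by linarith, ?_⟩
    linarith [norm_le_norm_add_norm_sub p q]
  · have hneg : LowerSemicontinuousOn (fun z => -U z) (Metric.closedBall z₀ ρ) := by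
      intro z hz y hy
      filter_upwards [hU z hz (-y) (by linarith)] with w hw
      linarith
    obtain ⟨z₁, z₂, p, q, h1, h2, h3, h4, h5, h6⟩ :=
      exists_superdiff_near_strongMax (U := fun z => -V z) (V := fun z => -U z) hb hρ hK hneg
        (fun z hz => by rw [abs_neg]; exact hVC z hz) (fun z hz => by rw [abs_neg]; exact hUC z hz)
        (fun z hz y hy => by rw [← abs_neg]; convert hVK z hz y hy using 2; ring)
        (fun η hη => by
          obtain ⟨δ, hδ, h⟩ := hmax η hη
          exact ⟨δ, hδ, fun z hz hle => h z hz (by linarith)⟩) hε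
    simp only [neg_neg] at h4
    refine ⟨z₂, z₁, -q, -p, h2, h1, h4, by rwa [neg_neg], ?_, ?_, ?_⟩
    · rwa [neg_sub_neg]
    · rw [norm_neg]
      linarith [norm_le_norm_add_norm_sub p q]
    · rw [norm_neg]
      linarith

lemma mem_psuperdiff_of_mem_superdiff {u : ℝ → X → ℝ} {z : ℝ × X} {p : ℝ × X →L[ℝ] ℝ}
    (hp : p ∈ superdiff (fun z : ℝ × X => u z.1 z.2) z) :
    (p (1, 0), p.comp (ContinuousLinearMap.inr ℝ ℝ X)) ∈ psuperdiff u z.1 z.2 := by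
  intro ε hε
  obtain ⟨δ, hδ, h⟩ := Metric.eventually_nhds_iff.1 (hp ε hε)
  refine ⟨δ, hδ, fun s k hsk _ => ?_⟩
  have hle : ‖(s, k)‖ ≤ |s| + ‖k‖ :=
    max_le (le_add_of_nonneg_right (norm_nonneg _)) (le_add_of_nonneg_left (abs_nonneg _))
  have h1 := @h (z + (s, k)) (by rw [dist_eq_norm, add_sub_cancel_left]; linarith)
  rw [add_sub_cancel_left] at h1
  have h2 : p (s, k) = p (1, 0) * s + p (0, k) := by
    rw [mul_comm, ← smul_eq_mul, ← map_smul, ← map_add]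
    simp
  rw [h2] at h1
  have h3 : ε * ‖(s, k)‖ ≤ ε * (|s| + ‖k‖) := by gcongr
  simp only [Prod.fst_add, Prod.snd_add] at h1
  simp only [ContinuousLinearMap.comp_apply, ContinuousLinearMap.inr_apply]
  linarith

lemma mem_psubdiff_of_neg_mem_superdiff {v : ℝ → X → ℝ} {z : ℝ × X} {q : ℝ × X →L[ℝ] ℝ}
    (hq : -q ∈ superdiff (fun z : ℝ × X => -v z.1 z.2) z) :
    (q (1, 0), q.comp (ContinuousLinearMap.inr ℝ ℝ X)) ∈ psubdiff v z.1 z.2 := by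
  intro ε hε
  obtain ⟨δ, hδ, h⟩ :=
    mem_psuperdiff_of_mem_superdiff (u := fun t x => -v t x) hq ε hε
  refine ⟨δ, hδ, fun s k hsk hs => ?_⟩
  have h1 := h s k hsk hs
  simp only [neg_apply, ContinuousLinearMap.comp_apply] at h1 ⊢
  linarith

/-- A function of time and space which is Lipschitz near a point for the metric
`|s - s'| + ‖y - y'‖` is Lipschitz on a small ball of `ℝ × Y`. -/
lemma exists_closedBall_lipschitz {Y : Type*} [NormedAddCommGroup Y] {w : ℝ → Y → ℝ}
    {z₀ : ℝ × Y} {S : Set (ℝ × Y)}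
    (hS : S ∈ 𝓝 z₀) (hS₀ : S ⊆ {z | 0 ≤ z.1})
    (hw : ∃ δ > (0:ℝ), ∃ K : ℝ, ∀ (s s' : ℝ) (y y' : Y), 0 ≤ s → 0 ≤ s' →
      |s - z₀.1| + ‖y - z₀.2‖ < δ → |s' - z₀.1| + ‖y' - z₀.2‖ < δ →
      |w s y - w s' y'| ≤ K * (|s - s'| + ‖y - y'‖)) :
    ∃ ρ K : ℝ, 0 < ρ ∧ Metric.closedBall z₀ ρ ⊆ S ∧ 0 ≤ K ∧
      ∀ z ∈ Metric.closedBall z₀ ρ, ∀ y ∈ Metric.closedBall z₀ ρ,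
        |w z.1 z.2 - w y.1 y.2| ≤ K * ‖z - y‖ := by
  obtain ⟨d, hd, K, hK⟩ := hw
  obtain ⟨ρ', hρ', hsub'⟩ := Metric.nhds_basis_closedBall.mem_iff.1 hS
  have hfst : ∀ z y : ℝ × Y, |z.1 - y.1| ≤ ‖z - y‖ := fun z y => norm_fst_le (z - y)
  have hsnd : ∀ z y : ℝ × Y, ‖z.2 - y.2‖ ≤ ‖z - y‖ := fun z y => norm_snd_le (z - y)
  have hsub : Metric.closedBall z₀ (min ρ' (d / 3)) ⊆ S :=
    (Metric.closedBall_subset_closedBall (min_le_left _ _)).trans hsub'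
  have hnear : ∀ z ∈ Metric.closedBall z₀ (min ρ' (d / 3)),
      |z.1 - z₀.1| + ‖z.2 - z₀.2‖ < d := by
    intro z hz
    rw [Metric.mem_closedBall, dist_eq_norm] at hz
    linarith [hfst z z₀, hsnd z z₀, min_le_right ρ' (d / 3)]
  refine ⟨min ρ' (d / 3), 2 * |K|, by positivity, hsub, by positivity, fun z hz y hy => ?_⟩
  calc _ ≤ K * (|z.1 - y.1| + ‖z.2 - y.2‖) :=
        hK _ _ _ _ (hS₀ (hsub hz)) (hS₀ (hsub hy)) (hnear z hz) (hnear y hy)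
    _ ≤ |K| * (‖z - y‖ + ‖z - y‖) := by
        gcongr
        · exact le_abs_self K
        · exact hfst z y
        · exact hsnd z y
    _ = _ := by ring

theorem stmt17 [CompleteSpace X] (hbump : HasC1LipBump X)
    (H : ℝ → X → ℝ → ℝ)
    (hHcont : ContinuousOn (fun p : ℝ × X × ℝ => H p.1 p.2.1 p.2.2)
      {p : ℝ × X × ℝ | 0 ≤ p.1})
    (hHA : CondAEvol H)
    (h : X → ℝ) (hhcont : Continuous h) (hhbdd : ∃ C : ℝ, ∀ x, |h x| ≤ C)
    (u v : ℝ → X → ℝ)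
    (hu : IsEvolSub H h u) (hv : IsEvolSuper H h v)
    (hbdd : ∀ T > (0:ℝ), ∃ C : ℝ, ∀ t : ℝ, 0 ≤ t → t < T → ∀ x : X,
      |u t x| ≤ C ∧ |v t x| ≤ C)
    (hLip : ∀ t : ℝ, 0 < t → ∀ x : X,
      (∃ δ > (0:ℝ), ∃ K : ℝ, ∀ (s s' : ℝ) (y y' : X), 0 ≤ s → 0 ≤ s' →
        |s - t| + ‖y - x‖ < δ → |s' - t| + ‖y' - x‖ < δ →
        |u s y - u s' y'| ≤ K * (|s - s'| + ‖y - y'‖)) ∨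
      (∃ δ > (0:ℝ), ∃ K : ℝ, ∀ (s s' : ℝ) (y y' : X), 0 ≤ s → 0 ≤ s' →
        |s - t| + ‖y - x‖ < δ → |s' - t| + ‖y' - x‖ < δ →
        |v s y - v s' y'| ≤ K * (|s - s'| + ‖y - y'‖))) :
    ∀ t : ℝ, 0 ≤ t → ∀ x : X, u t x ≤ v t x := by
  intro ts hts xs
  by_contra! hlt
  obtain ⟨b, L, hb⟩ := hbump.exists_isUnitBump
  obtain ⟨c, M, hc⟩ := hasC1LipBump_real.exists_isUnitBump
  obtain ⟨Cω, ω, hCω, hωcont, hω0, hA⟩ := hHA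
  obtain ⟨hu_usc, hu_sub, hu_zero⟩ := hu
  obtain ⟨hv_lsc, hv_super, hv_zero⟩ := hv
  obtain ⟨C, hC⟩ := hbdd (ts + 2) (by linarith)
  have hC0 : 0 ≤ C := (abs_nonneg _).trans (hC 0 le_rfl (by linarith) 0).1
  set m : ℝ := u ts xs - v ts xs with hm
  have hm0 : 0 < m := by linarith
  set k : ℝ := 4 * C / m + 1 with hk
  have hk0 : 0 < k := by positivity
  have hkm : m * k = 4 * C + m := by rw [hk]; field_simp
  set ψ : ℝ → ℝ := fun t => m / 2 * Real.exp (k * (t - ts)) with hψ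
  set ψ' : ℝ → ℝ := fun t => m / 2 * k * Real.exp (k * (t - ts)) with hψ'
  have hψd : ∀ t, HasDerivAt ψ (ψ' t) t := by
    intro t
    have h1 := ((((hasDerivAt_id t).sub_const ts).const_mul k).exp).const_mul (m / 2)
    refine h1.congr_deriv ?_
    simp only [hψ', id]
    ring
  set lam : ℝ := ψ' 0 with hlam
  have hlam0 : 0 < lam := by positivity
  have hψ'mono : Monotone ψ' := fun s t hst => by
    simp only [hψ']
    gcongr
  -- the scale at which `ω` is small
  obtain ⟨δ, hδ, hωδ⟩ : ∃ δ > 0, ∀ a a' a'' : ℝ, 0 ≤ a → |a| < δ → |a'| < δ → |a''| < δ →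
      ω a a' a'' < lam / 4 := by
    have h1 := Metric.continuousWithinAt_iff.1 (hωcont (0, 0, 0) (by simp)) (lam / 4)
      (by positivity)
    obtain ⟨δ, hδ, h⟩ := h1
    refine ⟨δ, hδ, fun a a' a'' ha h1 h2 h3 => ?_⟩
    have h4 := @h (a, a', a'') ha (by simp [Prod.dist_eq, h1, h2, h3])
    simp only [hω0, Real.dist_eq, sub_zero] at h4
    exact (abs_lt.1 h4).2
  obtain ⟨e, he0, hem, heδ, hel⟩ : ∃ e > 0, e ≤ m / 8 ∧ e ≤ δ / 4 ∧ e ≤ lam / 8 := by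
    refine ⟨min (m / 8) (min (δ / 4) (lam / 8)), by positivity, min_le_left _ _, ?_, ?_⟩
    · exact (min_le_right _ _).trans (min_le_left _ _)
    · exact (min_le_right _ _).trans (min_le_right _ _)
  set S : Set (ℝ × X) := Set.Icc 0 (ts + 1) ×ˢ Set.univ with hS
  have hScl : IsClosed S := isClosed_Icc.prod isClosed_univ
  have hSconv : Convex ℝ S := (convex_Icc _ _).prod convex_univ
  have hSC : ∀ z ∈ S, |u z.1 z.2| ≤ C ∧ |v z.1 z.2| ≤ C := fun z hz =>
    hC z.1 hz.1.1 (by linarith [hz.1.2]) z.2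
  have hSpos : S ⊆ {p : ℝ × X | 0 ≤ p.1} := fun z hz => hz.1.1
  have hψcont : Continuous ψ := continuous_iff_continuousAt.2 fun t => (hψd t).continuousAt
  have hneg_v : UpperSemicontinuousOn (fun z : ℝ × X => -v z.1 z.2) S := by
    intro z hz y hy
    filter_upwards [(hv_lsc.mono hSpos) z hz (-y) (by linarith)] with w hw
    linarith
  have hψ0 : ∀ t, 0 < ψ t := fun t => by positivity
  obtain ⟨g, hgd, hge, hge', z₀, hz₀, hgmax, hgstrong⟩ :=
    (hc.prod hb).exists_perturbation_strongMax (S := S)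
      (f := fun z => u z.1 z.2 + -v z.1 z.2 + -ψ z.1) hScl
      ⟨(ts, xs), ⟨hts, by simp⟩, trivial⟩
      (fun z hz => UpperSemicontinuousWithinAt.add
        (UpperSemicontinuousWithinAt.add (hu_usc.mono hSpos z hz) (hneg_v z hz))
        (hψcont.comp continuous_fst).neg.continuousWithinAt.upperSemicontinuousWithinAt)
      (by
        refine ⟨2 * C, ?_⟩
        rintro _ ⟨z, hz, rfl⟩
        have h1 := hSC z hz
        dsimp only
        linarith [(abs_le.1 h1.1).2, (abs_le.1 h1.2).1, hψ0 z.1]) he0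
  have hψts : ψ ts = m / 2 := by simp [hψ]
  have hval := hgmax (ts, xs) ⟨⟨hts, by simp⟩, trivial⟩
  dsimp only at hval
  have hpos : 0 < u z₀.1 z₀.2 - v z₀.1 z₀.2 - ψ z₀.1 := by
    linarith [(abs_le.1 (hge z₀)).2, (abs_le.1 (hge (ts, xs))).1]
  have ht₀ : 0 < z₀.1 := by
    refine lt_of_le_of_ne hz₀.1.1 fun h0 => ?_
    rw [← h0] at hpos
    linarith [hu_zero z₀.2, hv_zero z₀.2, hψ0 0]
  have ht₁ : z₀.1 < ts + 1 := by
    refine lt_of_le_of_ne hz₀.1.2 fun h1 => ?_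
    have h2 : 2 * C ≤ ψ z₀.1 := by
      simp only [hψ, h1, add_sub_cancel_left, mul_one]
      nlinarith [Real.add_one_le_exp k]
    have h3 := hSC z₀ hz₀
    linarith [(abs_le.1 h3.1).2, (abs_le.1 h3.2).1]
  set φ : ℝ × X → ℝ := fun z => ψ z.1 - g z with hφ
  set φ' : ℝ × X → (ℝ × X →L[ℝ] ℝ) := fun z =>
    ψ' z.1 • ContinuousLinearMap.fst ℝ ℝ X - fderiv ℝ g z with hφ'
  have hφd : ∀ z, HasFDerivAt φ (φ' z) z := fun z =>
    ((hψd z.1).comp_hasFDerivAt z hasFDerivAt_fst).sub (hgd z).hasFDerivAt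
  set P : ℝ := ψ' (ts + 1) + e with hP
  have hψ'0 : ∀ t, 0 < ψ' t := fun t => by positivity
  have hP0 : 0 < P := add_pos (hψ'0 _) he0
  have hφP : ∀ z ∈ S, ‖φ' z‖ ≤ P := by
    intro z hz
    refine (norm_sub_le _ _).trans (add_le_add ?_ (hge' z))
    rw [norm_smul, Real.norm_eq_abs, abs_of_pos (hψ'0 _)]
    exact (mul_le_of_le_one_right (hψ'0 _).le (ContinuousLinearMap.norm_fst_le ℝ ℝ X)).trans
      (hψ'mono hz.1.2)
  have hφlip : ∀ z ∈ S, ∀ y ∈ S, |φ z - φ y| ≤ P * ‖z - y‖ := fun z hz y hy =>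
    hSconv.norm_image_sub_le_of_norm_hasFDerivWithin_le
      (fun w _ => (hφd w).hasFDerivWithinAt) hφP hy hz
  obtain ⟨ρ, K, hρ, hρS, hK0, hUVK⟩ : ∃ ρ K : ℝ, 0 < ρ ∧ Metric.closedBall z₀ ρ ⊆ S ∧ 0 ≤ K ∧
      ((∀ z ∈ Metric.closedBall z₀ ρ, ∀ y ∈ Metric.closedBall z₀ ρ,
        |(u z.1 z.2 - φ z) - (u y.1 y.2 - φ y)| ≤ K * ‖z - y‖) ∨
      (∀ z ∈ Metric.closedBall z₀ ρ, ∀ y ∈ Metric.closedBall z₀ ρ,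
        |v z.1 z.2 - v y.1 y.2| ≤ K * ‖z - y‖)) := by
    have hS₀ : S ∈ 𝓝 z₀ := prod_mem_nhds (Icc_mem_nhds ht₀ ht₁) univ_mem
    rcases hLip z₀.1 ht₀ z₀.2 with h | h
    · obtain ⟨ρ, K, hρ, hsub, hK, hw⟩ := exists_closedBall_lipschitz hS₀ hSpos h
      refine ⟨ρ, K + P, hρ, hsub, by positivity, Or.inl fun z hz y hy => ?_⟩
      have h1 := abs_le.1 (hw z hz y hy)
      have h2 := abs_le.1 (hφlip z (hsub hz) y (hsub hy))
      exact abs_le.2 ⟨by linarith, by linarith⟩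
    · obtain ⟨ρ, K, hρ, hsub, hK, hw⟩ := exists_closedBall_lipschitz hS₀ hSpos h
      exact ⟨ρ, K, hρ, hsub, hK, Or.inr hw⟩
  have hφcont : Continuous φ := continuous_iff_continuousAt.2 fun z => (hφd z).continuousAt
  set K' : ℝ := K + P + 2 with hK'
  have hK'0 : 0 < K' := by positivity
  have hz₀B : z₀ ∈ Metric.closedBall z₀ ρ := Metric.mem_closedBall_self hρ.le
  obtain ⟨r, hr0, hrρ, hrδ, hrl, hr1, hrC⟩ : ∃ r > 0, r ≤ min ρ z₀.1 ∧ r ≤ δ / 4 ∧ r ≤ lam / 8 ∧ r ≤ 1 ∧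
      Cω * K' * (4 * r) ≤ lam / 4 := by
    refine ⟨min (min (min (min ρ z₀.1) (δ / 4)) (min (lam / 8) 1)) (lam / 16 / (Cω * K' + 1)),
      by positivity, ?_, ?_, ?_, ?_, ?_⟩
    · exact (min_le_left _ _).trans ((min_le_left _ _).trans (min_le_left _ _))
    · exact (min_le_left _ _).trans ((min_le_left _ _).trans (min_le_right _ _))
    · exact (min_le_left _ _).trans ((min_le_right _ _).trans (min_le_left _ _))
    · exact (min_le_left _ _).trans ((min_le_right _ _).trans (min_le_right _ _))
    · set r := min (min (min (min ρ z₀.1) (δ / 4)) (min (lam / 8) 1)) (lam / 16 / (Cω * K' + 1)) with hr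
      have h1 : r ≤ lam / 16 / (Cω * K' + 1) := min_le_right _ _
      rw [le_div_iff₀ (by positivity)] at h1
      have h2 : 0 < r := by positivity
      nlinarith
  obtain ⟨z₁, z₂, p, q, hz₁, hz₂, hp, hq, hpq, hpK, hqK⟩ :=
    exists_superdiff_subdiff_near_strongMax (hc.prod hb) (U := fun z => u z.1 z.2 - φ z)
      (V := fun z => v z.1 z.2) (z₀ := z₀) (ρ := ρ)
      (C := C + (|φ z₀| + P * ρ)) hρ hK0
      (fun z hz => by
        simp only [sub_eq_add_neg]
        exact UpperSemicontinuousWithinAt.add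
          ((hu_usc.mono (hρS.trans hSpos)) z hz)
          hφcont.neg.continuousWithinAt.upperSemicontinuousWithinAt)
      (hv_lsc.mono (hρS.trans hSpos))
      (fun z hz => by
        have h1 := (hSC z (hρS hz)).1
        have h2 := hφlip z (hρS hz) z₀ (hρS hz₀B)
        have h3 : P * ‖z - z₀‖ ≤ P * ρ := by
          rw [Metric.mem_closedBall, dist_eq_norm] at hz
          gcongr
        have h4 := abs_sub_abs_le_abs_sub (φ z) (φ z₀)
        linarith [abs_sub (u z.1 z.2) (φ z)])
      (fun z hz => (hSC z (hρS hz)).2.trans (le_add_of_nonneg_right (by positivity)))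
      hUVK
      (fun η hη => by
        obtain ⟨d, hd, h⟩ := hgstrong η hη
        refine ⟨d, hd, fun z hz hle => h z (hρS hz) ?_⟩
        simp only [hφ] at hle
        linarith) hr0
  have hmem : ∀ {z}, ‖z - z₀‖ < r → z ∈ Metric.closedBall z₀ ρ := fun {z} hz => by
    rw [Metric.mem_closedBall, dist_eq_norm]
    linarith [min_le_left ρ z₀.1]
  have hz₁S := hρS (hmem hz₁)
  have hpos_of_near : ∀ {z : ℝ × X}, ‖z - z₀‖ < r → 0 < z.1 := by
    intro z hz
    have h1 := abs_lt.1 ((norm_fst_le (z - z₀)).trans_lt hz)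
    rw [Prod.fst_sub] at h1
    linarith [min_le_right ρ z₀.1]
  have hsub := hu_sub z₁.1 (hpos_of_near hz₁) z₁.2 _
    (mem_psuperdiff_of_mem_superdiff (superdiff_add_fderiv hp (hφd z₁)))
  have hsup := hv_super z₂.1 (hpos_of_near hz₂) z₂.2 _ (mem_psubdiff_of_neg_mem_superdiff hq)
  set Δ₁ := (p + φ' z₁).comp (ContinuousLinearMap.inr ℝ ℝ X) with hΔ₁
  set Δ₂ := q.comp (ContinuousLinearMap.inr ℝ ℝ X) with hΔ₂
  have hinr : ∀ f : ℝ × X →L[ℝ] ℝ, ‖f.comp (ContinuousLinearMap.inr ℝ ℝ X)‖ ≤ ‖f‖ := fun f =>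
    (ContinuousLinearMap.opNorm_comp_le _ _).trans (mul_le_of_le_one_right (norm_nonneg _)
      (ContinuousLinearMap.norm_inr_le_one ℝ ℝ X))
  have hΔK₁ : ‖Δ₁‖ ≤ K' :=
    (hinr _).trans ((norm_add_le _ _).trans (by linarith [hφP z₁ hz₁S]))
  have hΔK₂ : ‖Δ₂‖ ≤ K' := (hinr _).trans (by linarith)
  have hdiff : Δ₁ - Δ₂ = (p - q - fderiv ℝ g z₁).comp (ContinuousLinearMap.inr ℝ ℝ X) := by
    ext y
    simp [hΔ₁, hΔ₂, hφ']
    ring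
  have hΔ : |‖Δ₁‖ - ‖Δ₂‖| < δ := by
    refine (abs_norm_sub_norm_le _ _).trans_lt ?_
    rw [hdiff]
    refine (hinr _).trans_lt ((norm_sub_le _ _).trans_lt ?_)
    linarith [hge' z₁]
  have hz₁₂ : ‖z₁ - z₂‖ < 2 * r := by
    rw [← dist_eq_norm] at hz₁ hz₂ ⊢
    linarith [dist_triangle_right z₁ z₂ z₀]
  have ht₁₂ : |z₁.1 - z₂.1| < 2 * r := (norm_fst_le (z₁ - z₂)).trans_lt hz₁₂
  have hx₁₂ : ‖z₁.2 - z₂.2‖ < 2 * r := (norm_snd_le (z₁ - z₂)).trans_lt hz₁₂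
  have hH := (abs_le.1 (hA z₁.1 z₂.1 (hpos_of_near hz₁).le (hpos_of_near hz₂).le z₁.2 z₂.2
    ‖Δ₁‖ ‖Δ₂‖)).1
  have hω := hωδ |z₁.1 - z₂.1| ‖z₁.2 - z₂.2‖ (‖Δ₁‖ - ‖Δ₂‖) (abs_nonneg _)
    (by rw [abs_abs]; linarith) (by rw [abs_norm]; linarith) hΔ
  have hCterm : Cω * max |‖Δ₁‖| |‖Δ₂‖| * (|z₁.1 - z₂.1| + ‖z₁.2 - z₂.2‖) ≤
      Cω * K' * (4 * r) := by
    rw [abs_norm, abs_norm]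
    gcongr
    · exact max_le hΔK₁ hΔK₂
    · linarith
  have hα : (p + φ' z₁) (1, 0) - q (1, 0) = (p - q - fderiv ℝ g z₁) (1, 0) + ψ' z₁.1 := by
    simp [hφ']
    ring
  have hα' : -(r + e) ≤ (p - q - fderiv ℝ g z₁) (1, 0) := by
    have h1 := (p - q - fderiv ℝ g z₁).le_opNorm (1, 0)
    have h2 : ‖((1 : ℝ), (0 : X))‖ = 1 := by simp [Prod.norm_def]
    rw [h2, mul_one, Real.norm_eq_abs] at h1
    linarith [(abs_le.1 h1).1, norm_sub_le (p - q) (fderiv ℝ g z₁), hge' z₁]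
  have hψ'₁ : lam ≤ ψ' z₁.1 := hψ'mono (hpos_of_near hz₁).le
  dsimp only at hsub hsup
  linarith
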